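/- Suppose c satisfies (A0), (A1), (A2), Ω is c*-convex with respect to Λ, and the c-segment {y_θ}_{0 ≤ θ ≤ 1} with respect to x_m lies in Λ. If c satisfies (A3W), then (d²/dθ²)f_θ(x) ≥ 0 for every θ ∈ [0,1] and every x ∈ S_θ. -/

import Mathlib

open scoped RealInnerProductSpace
open Filter Topology Set

noncomputable section

variable {n : ℕ}

local notation "E" => EuclideanSpace ℝ (Fin n)

/-- `-∇ₓ c(x,y)`, the negative gradient of `x' ↦ c(x',y)` at `x`. -/
def negGradX (c : E → E → ℝ) (x y : E) : E :=
  -(gradient (fun x' => c x' y) x)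

/-- `-∇_y c(x,y)`, the negative gradient of `y' ↦ c(x,y')` at `y`. -/
def negGradY (c : E → E → ℝ) (x y : E) : E :=
  -(gradient (fun y' => c x y') y)

/-- The swapped cost `c*(y,x) = c(x,y)`. -/
def cStar (c : E → E → ℝ) : E → E → ℝ := fun y x => c x y

/-- The domain of the `c`-exponential map at `x`: `{-∇ₓ c(x,y) : y ∈ Λ}`. -/
def cExpDom (c : E → E → ℝ) (Λ : Set E) (x : E) : Set E :=
  (fun y => negGradX c x y) '' Λ

/-- The `c`-exponential map: `cExp c Λ x p` is the point `y ∈ Λ` with `p = -∇ₓ c(x,y)`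
(when it exists and is unique). -/
def cExp (c : E → E → ℝ) (Λ : Set E) (x p : E) : E :=
  Function.invFunOn (fun y => negGradX c x y) Λ p

/-- Condition (A0): the cost extends to a `C⁴` function on `cl Ω × cl Λ`. -/
def A0 (c : E → E → ℝ) (Ω Λ : Set E) : Prop :=
  ContDiffOn ℝ 4 (fun q : E × E => c q.1 q.2) (closure Ω ×ˢ closure Λ)

/-- Condition (A1): injectivity of `y ↦ -∇ₓ c(x,y)` on `cl Λ` and of
`x ↦ -∇_y c(x,y)` on `cl Ω`. -/
def A1 (c : E → E → ℝ) (Ω Λ : Set E) : Prop :=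
  (∀ x ∈ Ω, Set.InjOn (fun y => negGradX c x y) (closure Λ)) ∧
  (∀ y ∈ Λ, Set.InjOn (fun x => negGradY c x y) (closure Ω))

/-- Condition (A2): the mixed second derivative `D²ₓᵧ c(x,y)`, as a linear map, is
invertible for all `(x,y) ∈ cl Ω × cl Λ`. -/
def A2 (c : E → E → ℝ) (Ω Λ : Set E) : Prop :=
  ∀ x ∈ closure Ω, ∀ y ∈ closure Λ,
    Function.Bijective (fderiv ℝ (fun y' => negGradX c x y') y)

/-- The `c`-sectional curvature
`𝔖_c(x,y)(η,ξ) = (d²/dt²)|₀ [-D²ₓₓ c](x, cExpₓ(p + tξ))(η,η)` with `p = -∇ₓ c(x,y)`. -/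
def cSectional (c : E → E → ℝ) (Λ : Set E) (x y η ξ : E) : ℝ :=
  deriv (deriv (fun t : ℝ =>
    -(iteratedFDeriv ℝ 2
        (fun x' => c x' (cExp c Λ x (negGradX c x y + t • ξ))) x ![η, η]))) 0

/-- Condition (A3W): nonnegative `c`-sectional curvature in orthogonal directions. -/
def A3W (c : E → E → ℝ) (Ω Λ : Set E) : Prop :=
  ∀ x ∈ Ω, ∀ y ∈ Λ, ∀ η ξ : E, ⟪η, ξ⟫ = 0 → 0 ≤ cSectional c Λ x y η ξ

/-- Condition (A3S): uniformly positive `c`-sectional curvature in orthogonal directions. -/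
def A3S (c : E → E → ℝ) (Ω Λ : Set E) : Prop :=
  ∃ C₀ > (0:ℝ), ∀ x ∈ Ω, ∀ y ∈ Λ, ∀ η ξ : E, ⟪η, ξ⟫ = 0 →
    C₀ * ‖η‖ ^ 2 * ‖ξ‖ ^ 2 ≤ cSectional c Λ x y η ξ

/-- `Λ` is `c`-convex with respect to `Ω`: `(cExpₓ)⁻¹(Λ)` is convex for every `x ∈ Ω`. -/
def CConvexTarget (c : E → E → ℝ) (Ω Λ : Set E) : Prop :=
  ∀ x ∈ Ω, Convex ℝ (cExpDom c Λ x)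

/-- `Ω` is `c*`-convex with respect to `Λ`: `(c*Exp_y)⁻¹(Ω)` is convex for every `y ∈ Λ`. -/
def CStarConvexSource (c : E → E → ℝ) (Ω Λ : Set E) : Prop :=
  ∀ y ∈ Λ, Convex ℝ ((fun x => negGradY c x y) '' Ω)

/-- The `c`-Legendre transform `L^c v(x) = sup_{y ∈ Λ} (-c(x,y) - v(y))`. -/
def cTransform (c : E → E → ℝ) (Λ : Set E) (v : E → EReal) (x : E) : EReal :=
  ⨆ y ∈ Λ, (((-(c x y) : ℝ) : EReal) - v y)

/-- `φ` is a `c`-convex function on `Ω` indexed by `Λ`. -/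
def IsCConvexOn (c : E → E → ℝ) (Ω Λ : Set E) (φ : E → ℝ) : Prop :=
  ∃ v : E → EReal,
    (∀ x ∈ Ω, (φ x : EReal) = cTransform c Λ v x) ∧
    (∀ x ∈ Ω, ∃ y ∈ closure Λ, (φ x : EReal) + v y = ((-(c x y) : ℝ) : EReal))

/-- The `c*`-Legendre transform `L^{c*} φ(y) = sup_{x ∈ Ω} (-c(x,y) - φ(x))`. -/
def cStarTransform (c : E → E → ℝ) (Ω : Set E) (φ : E → ℝ) (y : E) : EReal :=
  ⨆ x ∈ Ω, (((-(c x y) - φ x : ℝ)) : EReal)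

/-- The contact set `G_φ(x) = {y ∈ cl Λ : φ(x) + L^{c*}φ(y) = -c(x,y)}`. -/
def contactSet (c : E → E → ℝ) (Ω Λ : Set E) (φ : E → ℝ) (x : E) : Set E :=
  {y ∈ closure Λ | (φ x : EReal) + cStarTransform c Ω φ y = ((-(c x y) : ℝ) : EReal)}

/-- The (local) subdifferential `∂φ(x)`:
`φ(z) ≥ φ(x) + ⟨p, z - x⟩ + o(‖z - x‖)` as `z → x` in `Ω`. -/
def subdiff (Ω : Set E) (φ : E → ℝ) (x : E) : Set E :=
  {p : E | ∀ ε > (0:ℝ), ∀ᶠ z in 𝓝[Ω] x,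
      φ x + ⟪p, z - x⟫ - ε * ‖z - x‖ ≤ φ z}

/-- The `c`-subdifferential `∂^c φ(x) = {-∇ₓ c(x,y) : y ∈ G_φ(x)}`. -/
def cSubdiff (c : E → E → ℝ) (Ω Λ : Set E) (φ : E → ℝ) (x : E) : Set E :=
  (fun y => negGradX c x y) '' contactSet c Ω Λ φ x

/-- The straight segment `p_θ = (1-θ) p₀ + θ p₁` with `pᵢ = -∇ₓ c(x_m, yᵢ)`. -/
def pSeg (c : E → E → ℝ) (xm y₀ y₁ : E) (θ : ℝ) : E :=
  (1 - θ) • negGradX c xm y₀ + θ • negGradX c xm y₁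

/-- The `c`-segment `y_θ = cExp_{x_m}(p_θ)` joining `y₀` to `y₁` with respect to `x_m`. -/
def ySeg (c : E → E → ℝ) (Λ : Set E) (xm y₀ y₁ : E) (θ : ℝ) : E :=
  cExp c Λ xm (pSeg c xm y₀ y₁ θ)

/-- The sliding mountain `f_θ(x) = -c(x, y_θ) + c(x_m, y_θ)`. -/
def slide (c : E → E → ℝ) (Λ : Set E) (xm y₀ y₁ : E) (θ : ℝ) (x : E) : ℝ :=
  -(c x (ySeg c Λ xm y₀ y₁ θ)) + c xm (ySeg c Λ xm y₀ y₁ θ)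

/-- The `c`-segment `[y₀,y₁]_{x_m}` lies in `Λ`:
each `p_θ`, `θ ∈ [0,1]`, is in the domain of `cExp_{x_m}`. -/
def segInTarget (c : E → E → ℝ) (Λ : Set E) (xm y₀ y₁ : E) : Prop :=
  ∀ θ ∈ Set.Icc (0:ℝ) 1, pSeg c xm y₀ y₁ θ ∈ cExpDom c Λ xm

/-- The level set `S_θ = {x ∈ Ω : (d/dθ) f_θ(x) = 0}`. -/
def Slevel (c : E → E → ℝ) (Ω Λ : Set E) (xm y₀ y₁ : E) (θ : ℝ) : Set E :=
  {x ∈ Ω | deriv (fun θ' => slide c Λ xm y₀ y₁ θ' x) θ = 0}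

/-- The super-level set `S⁺_θ = {x ∈ Ω : (d/dθ) f_θ(x) ≥ 0}`. -/
def Splus (c : E → E → ℝ) (Ω Λ : Set E) (xm y₀ y₁ : E) (θ : ℝ) : Set E :=
  {x ∈ Ω | 0 ≤ deriv (fun θ' => slide c Λ xm y₀ y₁ θ' x) θ}

section DirectionalDerivative

variable {W V : Type*} [NormedAddCommGroup W] [NormedSpace ℝ W]
  [NormedAddCommGroup V] [NormedSpace ℝ V]

/-- The directional derivative of `G` in the constant direction `u`. -/
def dirDeriv (u : W) (G : W → ℝ) (q : W) : ℝ := fderiv ℝ G q u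

theorem ContDiffAt.dirDeriv {m k : WithTop ℕ∞} {G : W → ℝ} {q : W} (hG : ContDiffAt ℝ k G q)
    (hk : m + 1 ≤ k) (u : W) : ContDiffAt ℝ m (dirDeriv u G) q :=
  (hG.fderiv_right hk).clm_apply contDiffAt_const

theorem Filter.EventuallyEq.dirDeriv {G H : W → ℝ} {q : W} (h : G =ᶠ[𝓝 q] H) (u : W) :
    dirDeriv u G =ᶠ[𝓝 q] dirDeriv u H :=
  h.fderiv.mono fun _ hz => congrArg (fun L : W →L[ℝ] ℝ => L u) hz

theorem dirDeriv_dirDeriv {G : W → ℝ} {q : W} (hG : ContDiffAt ℝ 2 G q) (u w : W) :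
    dirDeriv u (dirDeriv w G) q = fderiv ℝ (fderiv ℝ G) q u w := by
  have hd : DifferentiableAt ℝ (fderiv ℝ G) q :=
    (hG.fderiv_right (m := 1) (by norm_num)).differentiableAt (by norm_num)
  change fderiv ℝ (fun z => fderiv ℝ G z w) q u = _
  rw [fderiv_clm_apply hd (differentiableAt_const w)]
  simp

theorem dirDeriv_comm {G : W → ℝ} {q : W} (hG : ContDiffAt ℝ 2 G q) (u w : W) :
    dirDeriv u (dirDeriv w G) q = dirDeriv w (dirDeriv u G) q := by
  rw [dirDeriv_dirDeriv hG, dirDeriv_dirDeriv hG]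
  exact hG.isSymmSndFDerivAt (by simp) u w

theorem dirDeriv_comm_eventually {G : W → ℝ} {q : W} (hG : ContDiffAt ℝ 2 G q) (u w : W) :
    dirDeriv u (dirDeriv w G) =ᶠ[𝓝 q] dirDeriv w (dirDeriv u G) :=
  (hG.eventually (by simp)).mono fun _ hz => dirDeriv_comm hz u w

theorem dirDeriv_comm_sq {G : W → ℝ} {q : W} (hG : ContDiffAt ℝ 3 G q) (u w : W) :
    dirDeriv u (dirDeriv w (dirDeriv w G)) =ᶠ[𝓝 q] dirDeriv w (dirDeriv w (dirDeriv u G)) :=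
  (dirDeriv_comm_eventually (hG.dirDeriv (by norm_num) w) u w).trans
    ((dirDeriv_comm_eventually (hG.of_le (by norm_num)) u w).dirDeriv w)

theorem dirDeriv_sq_comm_sq {G : W → ℝ} {q : W} (hG : ContDiffAt ℝ 4 G q) (u w : W) :
    dirDeriv u (dirDeriv u (dirDeriv w (dirDeriv w G))) q =
      dirDeriv w (dirDeriv w (dirDeriv u (dirDeriv u G))) q :=
  (((dirDeriv_comm_sq (hG.of_le (by norm_num)) u w).dirDeriv u).trans
    (dirDeriv_comm_sq (hG.dirDeriv (by norm_num) u) u w)).eq_of_nhds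

theorem deriv_comp_eq_dirDeriv {G : W → ℝ} {γ : ℝ → W} {γ' : W} {t : ℝ}
    (hG : DifferentiableAt ℝ G (γ t)) (hγ : HasDerivAt γ γ' t) :
    HasDerivAt (fun s => G (γ s)) (dirDeriv γ' G (γ t)) t :=
  hG.hasFDerivAt.comp_hasDerivAt t hγ

/-- The second derivative of a function along a curve. -/
theorem deriv_deriv_comp_eq_dirDeriv {G : W → ℝ} {γ γ' : ℝ → W} {γ'' : W} {t : ℝ}
    (hG : ContDiffAt ℝ 2 G (γ t)) (hγ : ∀ᶠ s in 𝓝 t, HasDerivAt γ (γ' s) s)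
    (hγ' : HasDerivAt γ' γ'' t) :
    deriv (deriv fun s => G (γ s)) t =
      dirDeriv (γ' t) (dirDeriv (γ' t) G) (γ t) + dirDeriv γ'' G (γ t) := by
  have hev : ∀ᶠ s in 𝓝 t, ContDiffAt ℝ 2 G (γ s) :=
    hγ.self_of_nhds.continuousAt.eventually (hG.eventually (by simp))
  have hd : deriv (fun s => G (γ s)) =ᶠ[𝓝 t] fun s => fderiv ℝ G (γ s) (γ' s) := by
    filter_upwards [hγ, hev] with s hs hGs
    exact (deriv_comp_eq_dirDeriv (hGs.differentiableAt (by norm_num)) hs).deriv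
  have hdG : DifferentiableAt ℝ (fderiv ℝ G) (γ t) :=
    (hG.fderiv_right (m := 1) (by norm_num)).differentiableAt (by norm_num)
  rw [hd.deriv_eq, dirDeriv_dirDeriv hG]
  exact ((hdG.hasFDerivAt.comp_hasDerivAt t hγ.self_of_nhds).clm_apply hγ').deriv

theorem ContDiffAt.eventually_hasDerivAt {γ : ℝ → V} {t : ℝ} (hγ : ContDiffAt ℝ 2 γ t) :
    (∀ᶠ s in 𝓝 t, HasDerivAt γ (deriv γ s) s) ∧ HasDerivAt (deriv γ) (deriv (deriv γ) t) t := by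
  constructor
  · filter_upwards [hγ.eventually (by simp)] with s hs
    exact (hs.differentiableAt (by norm_num)).hasDerivAt
  · have : ContDiffAt ℝ 1 (deriv γ) t :=
      (hγ.fderiv_right (m := 1) (by norm_num)).clm_apply contDiffAt_const
    exact (this.differentiableAt (by norm_num)).hasDerivAt

theorem deriv_deriv_comp_right {G : V × W → ℝ} {x : V} {γ : ℝ → W} {t : ℝ}
    (hG : ContDiffAt ℝ 2 G (x, γ t)) (hγ : ContDiffAt ℝ 2 γ t) :
    deriv (deriv fun s => G (x, γ s)) t =
      dirDeriv (0, deriv γ t) (dirDeriv (0, deriv γ t) G) (x, γ t) +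
        dirDeriv (0, deriv (deriv γ) t) G (x, γ t) :=
  deriv_deriv_comp_eq_dirDeriv (γ := fun s => (x, γ s)) (γ' := fun s => (0, deriv γ s)) hG
    (hγ.eventually_hasDerivAt.1.mono fun s hs => (hasDerivAt_const s x).prodMk hs)
    ((hasDerivAt_const t 0).prodMk hγ.eventually_hasDerivAt.2)

theorem deriv_deriv_comp_left {G : V × W → ℝ} {y : W} {γ : ℝ → V} {t : ℝ}
    (hG : ContDiffAt ℝ 2 G (γ t, y)) (hγ : ContDiffAt ℝ 2 γ t) :
    deriv (deriv fun s => G (γ s, y)) t =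
      dirDeriv (deriv γ t, 0) (dirDeriv (deriv γ t, 0) G) (γ t, y) +
        dirDeriv (deriv (deriv γ) t, 0) G (γ t, y) :=
  deriv_deriv_comp_eq_dirDeriv (γ := fun s => (γ s, y)) (γ' := fun s => (deriv γ s, 0)) hG
    (hγ.eventually_hasDerivAt.1.mono fun s hs => hs.prodMk (hasDerivAt_const s y))
    (hγ.eventually_hasDerivAt.2.prodMk (hasDerivAt_const t 0))

theorem deriv_comp_right {G : V × W → ℝ} {x : V} {γ : ℝ → W} {t : ℝ}
    (hG : DifferentiableAt ℝ G (x, γ t)) (hγ : DifferentiableAt ℝ γ t) :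
    HasDerivAt (fun s => G (x, γ s)) (dirDeriv (0, deriv γ t) G (x, γ t)) t :=
  deriv_comp_eq_dirDeriv (γ := fun s => (x, γ s)) hG
    ((hasDerivAt_const t x).prodMk hγ.hasDerivAt)

theorem deriv_comp_left {G : V × W → ℝ} {y : W} {γ : ℝ → V} {t : ℝ}
    (hG : DifferentiableAt ℝ G (γ t, y)) (hγ : DifferentiableAt ℝ γ t) :
    HasDerivAt (fun s => G (γ s, y)) (dirDeriv (deriv γ t, 0) G (γ t, y)) t :=
  deriv_comp_eq_dirDeriv (γ := fun s => (γ s, y)) hG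
    (hγ.hasDerivAt.prodMk (hasDerivAt_const t y))

theorem fderiv_left_apply {G : V × W → ℝ} {x : V} {y : W}
    (hG : DifferentiableAt ℝ G (x, y)) (u : V) :
    fderiv ℝ (fun x' => G (x', y)) x u = dirDeriv (u, 0) G (x, y) := by
  have := (HasFDerivAt.comp (f := fun x' => (x', y)) x hG.hasFDerivAt
    (hasFDerivAt_prodMk_left x y)).fderiv
  change fderiv ℝ (G ∘ fun x' => (x', y)) x u = _
  rw [this]
  simp [dirDeriv]

theorem fderiv_right_apply {G : V × W → ℝ} {x : V} {y : W}
    (hG : DifferentiableAt ℝ G (x, y)) (u : W) :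
    fderiv ℝ (fun y' => G (x, y')) y u = dirDeriv (0, u) G (x, y) := by
  have := (HasFDerivAt.comp (f := fun y' => (x, y')) y hG.hasFDerivAt
    (hasFDerivAt_prodMk_right x y)).fderiv
  change fderiv ℝ (G ∘ fun y' => (x, y')) y u = _
  rw [this]
  simp [dirDeriv]

theorem iteratedFDeriv_two_left {G : V × W → ℝ} {x : V} {y : W}
    (hG : ContDiffAt ℝ 2 G (x, y)) (u : V) :
    iteratedFDeriv ℝ 2 (fun x' => G (x', y)) x ![u, u] =
      dirDeriv (u, 0) (dirDeriv (u, 0) G) (x, y) := by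
  have hs : ContDiffAt ℝ 2 (fun x' => G (x', y)) x :=
    hG.comp x (contDiffAt_id.prodMk contDiffAt_const)
  have hev : ∀ᶠ x' in 𝓝 x, DifferentiableAt ℝ G (x', y) := by
    have hc : ContinuousAt (fun x' : V => (x', y)) x := by fun_prop
    filter_upwards [hc.eventually (hG.eventually (by simp))] with x' hx'
    exact hx'.differentiableAt (by norm_num)
  have hfd : dirDeriv u (fun x' => G (x', y)) =ᶠ[𝓝 x]
      fun x' => dirDeriv (u, 0) G (x', y) :=
    hev.mono fun x' hx' => fderiv_left_apply hx' u
  rw [iteratedFDeriv_two_apply]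
  simp only [Matrix.cons_val_zero, Matrix.cons_val_one]
  rw [← dirDeriv_dirDeriv hs, (hfd.dirDeriv u).eq_of_nhds]
  exact fderiv_left_apply ((hG.dirDeriv (m := 1) (by norm_num) _).differentiableAt (by norm_num)) u

end DirectionalDerivative

section Inverse

variable {V : Type*} [NormedAddCommGroup V] [NormedSpace ℝ V] [FiniteDimensional ℝ V]

/-- The set-theoretic inverse of an injective `C^k` map with invertible derivative on an open set
is `C^k`, and is a right inverse near each point of the image. -/
theorem contDiffAt_invFunOn [Nonempty V] {f : V → V} {s : Set V} {a : V} {k : WithTop ℕ∞}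
    (hk : k ≠ 0) (hs : IsOpen s) (ha : a ∈ s) (hf : ContDiffAt ℝ k f a) (hinj : InjOn f s)
    (hb : Function.Injective (fderiv ℝ f a)) :
    ContDiffAt ℝ k (Function.invFunOn f s) (f a) ∧
      ∀ᶠ p in 𝓝 (f a), Function.invFunOn f s p ∈ s ∧ f (Function.invFunOn f s p) = p := by
  have : CompleteSpace V := FiniteDimensional.complete ℝ V
  let e : V ≃L[ℝ] V :=
    (LinearEquiv.ofInjectiveEndo (fderiv ℝ f a : V →ₗ[ℝ] V) hb).toContinuousLinearEquiv
  have he : HasFDerivAt f (e : V →L[ℝ] V) a := by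
    have : (e : V →L[ℝ] V) = fderiv ℝ f a := by ext; rfl
    rw [this]
    exact (hf.differentiableAt hk).hasFDerivAt
  have hC := hf.to_localInverse he hk
  have hright : ∀ᶠ p in 𝓝 (f a), f (hf.localInverse he hk p) = p :=
    (hf.hasStrictFDerivAt' he hk).eventually_right_inverse
  have hmem : ∀ᶠ p in 𝓝 (f a), hf.localInverse he hk p ∈ s := by
    refine hC.continuousAt.eventually_mem (hs.mem_nhds ?_)
    rwa [hf.localInverse_apply_image he hk]
  have key : ∀ᶠ p in 𝓝 (f a), Function.invFunOn f s p ∈ s ∧ f (Function.invFunOn f s p) = p := by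
    filter_upwards [hright, hmem] with p hp hps
    exact Function.invFunOn_pos ⟨_, hps, hp⟩
  refine ⟨hC.congr_of_eventuallyEq ?_, key⟩
  filter_upwards [hright, hmem, key] with p hp hps hk'
  exact hinj hk'.1 hps (hk'.2.trans hp.symm)

end Inverse

/-- A function with nonnegative second derivative on `[0,1]` and a critical point at `0`
does not decrease from `0` to `1`. -/
theorem le_of_deriv_zero_of_deriv_deriv_nonneg {g : ℝ → ℝ}
    (hg : ∀ t ∈ Icc (0 : ℝ) 1, ContDiffAt ℝ 2 g t) (h0 : deriv g 0 = 0)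
    (h2 : ∀ t ∈ Icc (0 : ℝ) 1, 0 ≤ deriv (deriv g) t) : g 0 ≤ g 1 := by
  have hd : ∀ t ∈ Icc (0 : ℝ) 1, DifferentiableAt ℝ g t := fun t ht =>
    (hg t ht).differentiableAt (by norm_num)
  have hd' : ∀ t ∈ Icc (0 : ℝ) 1, DifferentiableAt ℝ (deriv g) t := fun t ht =>
    (hg t ht).eventually_hasDerivAt.2.differentiableAt
  have hm : MonotoneOn (deriv g) (Icc 0 1) :=
    monotoneOn_of_deriv_nonneg (convex_Icc 0 1)
      (fun t ht => (hd' t ht).continuousAt.continuousWithinAt)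
      (fun t ht => (hd' t (interior_subset ht)).differentiableWithinAt)
      (fun t ht => h2 t (interior_subset ht))
  have hmg : MonotoneOn g (Icc 0 1) :=
    monotoneOn_of_deriv_nonneg (convex_Icc 0 1)
      (fun t ht => (hd t ht).continuousAt.continuousWithinAt)
      (fun t ht => (hd t (interior_subset ht)).differentiableWithinAt)
      (fun t ht => h0 ▸ hm (by simp) (interior_subset ht) (interior_subset ht).1)
  exact hmg (by simp) (by simp) zero_le_one

/-- The cost as a function on the product space. -/
def costPair (c : E → E → ℝ) (q : E × E) : ℝ := c q.1 q.2

theorem inner_negGradX {c : E → E → ℝ} {x y : E}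
    (h : DifferentiableAt ℝ (costPair c) (x, y)) (w : E) :
    ⟪negGradX c x y, w⟫ = -dirDeriv (w, 0) (costPair c) (x, y) := by
  rw [negGradX, inner_neg_left, inner_gradient_left, ← fderiv_left_apply h]
  rfl

theorem inner_negGradY {c : E → E → ℝ} {x y : E}
    (h : DifferentiableAt ℝ (costPair c) (x, y)) (w : E) :
    ⟪negGradY c x y, w⟫ = -dirDeriv (0, w) (costPair c) (x, y) := by
  rw [negGradY, inner_neg_left, inner_gradient_left, ← fderiv_right_apply h]
  rfl


theorem eventually_differentiableAt_left {c : E → E → ℝ} {x y : E} {k : WithTop ℕ∞}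
    (hk : 1 ≤ k) (h : ContDiffAt ℝ k (costPair c) (x, y)) :
    ∀ᶠ x' in 𝓝 x, DifferentiableAt ℝ (costPair c) (x', y) := by
  have hc : ContinuousAt (fun x' : E => (x', y)) x := by fun_prop
  filter_upwards [hc.eventually ((h.of_le hk).eventually (by simp))] with x' hx'
  exact hx'.differentiableAt (by norm_num)

theorem eventually_differentiableAt_right {c : E → E → ℝ} {x y : E} {k : WithTop ℕ∞}
    (hk : 1 ≤ k) (h : ContDiffAt ℝ k (costPair c) (x, y)) :
    ∀ᶠ y' in 𝓝 y, DifferentiableAt ℝ (costPair c) (x, y') := by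
  have hc : ContinuousAt (fun y' : E => (x, y')) y := by fun_prop
  filter_upwards [hc.eventually ((h.of_le hk).eventually (by simp))] with y' hy'
  exact hy'.differentiableAt (by norm_num)

theorem contDiffAt_of_inner {f : E → E} {a : E} {k : WithTop ℕ∞}
    (h : ∀ w, ContDiffAt ℝ k (fun z => ⟪f z, w⟫) a) : ContDiffAt ℝ k f a := by
  rw [contDiffAt_euclidean]
  intro i
  simpa [EuclideanSpace.inner_single_right] using h (EuclideanSpace.single i 1)

theorem contDiffAt_negGradX {c : E → E → ℝ} {x y : E}
    (h : ContDiffAt ℝ 4 (costPair c) (x, y)) :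
    ContDiffAt ℝ 2 (fun y' => negGradX c x y') y := by
  refine contDiffAt_of_inner fun w => ?_
  have hw : ContDiffAt ℝ 2 (fun y' => -dirDeriv (w, 0) (costPair c) (x, y')) y :=
    ((h.dirDeriv (m := 2) (by norm_num) (w, 0)).comp y
      (contDiffAt_const.prodMk contDiffAt_id)).neg
  refine hw.congr_of_eventuallyEq ?_
  filter_upwards [eventually_differentiableAt_right (by norm_num) h] with y' hy'
  exact inner_negGradX hy' w

theorem contDiffAt_negGradY {c : E → E → ℝ} {x y : E}
    (h : ContDiffAt ℝ 4 (costPair c) (x, y)) :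
    ContDiffAt ℝ 2 (fun x' => negGradY c x' y) x := by
  refine contDiffAt_of_inner fun w => ?_
  have hw : ContDiffAt ℝ 2 (fun x' => -dirDeriv (0, w) (costPair c) (x', y)) x :=
    ((h.dirDeriv (m := 2) (by norm_num) (0, w)).comp x
      (contDiffAt_id.prodMk contDiffAt_const)).neg
  refine hw.congr_of_eventuallyEq ?_
  filter_upwards [eventually_differentiableAt_left (by norm_num) h] with x' hx'
  exact inner_negGradY hx' w

theorem inner_fderiv_apply {f : E → E} {a : E} (hf : DifferentiableAt ℝ f a) (v w : E) :
    ⟪fderiv ℝ f a v, w⟫ = fderiv ℝ (fun z => ⟪f z, w⟫) a v := by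
  rw [fderiv_inner_apply ℝ hf (differentiableAt_const w)]
  simp

theorem inner_fderiv_negGradX {c : E → E → ℝ} {x y : E}
    (h : ContDiffAt ℝ 4 (costPair c) (x, y)) (v w : E) :
    ⟪fderiv ℝ (fun y' => negGradX c x y') y v, w⟫ =
      -dirDeriv (0, v) (dirDeriv (w, 0) (costPair c)) (x, y) := by
  rw [inner_fderiv_apply ((contDiffAt_negGradX h).differentiableAt (by norm_num))]
  have hev : (fun y' => ⟪negGradX c x y', w⟫) =ᶠ[𝓝 y]
      fun y' => -dirDeriv (w, 0) (costPair c) (x, y') := by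
    filter_upwards [eventually_differentiableAt_right (by norm_num) h] with y' hy'
    exact inner_negGradX hy' w
  rw [hev.fderiv_eq, fderiv_fun_neg, ← fderiv_right_apply
    ((h.dirDeriv (m := 2) (by norm_num) (w, 0)).differentiableAt (by norm_num))]
  rfl

theorem inner_fderiv_negGradY {c : E → E → ℝ} {x y : E}
    (h : ContDiffAt ℝ 4 (costPair c) (x, y)) (v w : E) :
    ⟪fderiv ℝ (fun x' => negGradY c x' y) x v, w⟫ =
      -dirDeriv (v, 0) (dirDeriv (0, w) (costPair c)) (x, y) := by
  rw [inner_fderiv_apply ((contDiffAt_negGradY h).differentiableAt (by norm_num))]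
  have hev : (fun x' => ⟪negGradY c x' y, w⟫) =ᶠ[𝓝 x]
      fun x' => -dirDeriv (0, w) (costPair c) (x', y) := by
    filter_upwards [eventually_differentiableAt_left (by norm_num) h] with x' hx'
    exact inner_negGradY hx' w
  rw [hev.fderiv_eq, fderiv_fun_neg, ← fderiv_left_apply
    ((h.dirDeriv (m := 2) (by norm_num) (0, w)).differentiableAt (by norm_num))]
  rfl

/-- The two mixed second derivatives are adjoint to each other. -/
theorem injective_fderiv_negGradY {c : E → E → ℝ} {x y : E}
    (h : ContDiffAt ℝ 4 (costPair c) (x, y))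
    (hs : Function.Surjective (fderiv ℝ (fun y' => negGradX c x y') y)) :
    Function.Injective (fderiv ℝ (fun x' => negGradY c x' y) x) := by
  rw [injective_iff_map_eq_zero]
  intro v hv
  obtain ⟨u, hu⟩ := hs v
  rw [← inner_self_eq_zero (𝕜 := ℝ)]
  nth_rewrite 1 [← hu]
  rw [inner_fderiv_negGradX h, dirDeriv_comm (h.of_le (by norm_num)),
    ← inner_fderiv_negGradY h, hv, inner_zero_left]

/-- The preimage of a line under an injective `C²` map with invertible derivative. -/
theorem contDiffAt_invFunOn_line {f : E → E} {s : Set E} (hs : IsOpen s)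
    (hf : ∀ a ∈ s, ContDiffAt ℝ 2 f a) (hinj : InjOn f s)
    (hb : ∀ a ∈ s, Function.Injective (fderiv ℝ f a)) {p ξ : E} {t : ℝ}
    (ht : p + t • ξ ∈ f '' s) :
    ContDiffAt ℝ 2 (fun r : ℝ => Function.invFunOn f s (p + r • ξ)) t ∧
      ∀ᶠ r : ℝ in 𝓝 t, Function.invFunOn f s (p + r • ξ) ∈ s ∧
        f (Function.invFunOn f s (p + r • ξ)) = p + r • ξ := by
  obtain ⟨a, ha, hat⟩ := ht
  obtain ⟨h1, h2⟩ := contDiffAt_invFunOn (by norm_num) hs ha (hf a ha) hinj (hb a ha)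
  rw [hat] at h1 h2
  have hl : ContDiff ℝ 2 (fun r : ℝ => p + r • ξ) := by fun_prop
  exact ⟨ContDiffAt.comp (f := fun r : ℝ => p + r • ξ) t h1 hl.contDiffAt,
    hl.continuous.continuousAt.eventually h2⟩

theorem deriv_deriv_affine (a b t : ℝ) : deriv (deriv fun s : ℝ => a + s * b) t = 0 := by
  have : deriv (fun s : ℝ => a + s * b) = fun _ => b := by
    funext s
    simp
  rw [this, deriv_const]

/-- Along a `c`-segment the `x`-derivative of the cost is affine. -/
theorem dirDeriv_of_negGradX_line {c : E → E → ℝ} {x : E} {γ : ℝ → E} {t : ℝ} {p ξ : E}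
    (h : ContDiffAt ℝ 4 (costPair c) (x, γ t)) (hγ : ContDiffAt ℝ 2 γ t)
    (hl : ∀ᶠ s in 𝓝 t, negGradX c x (γ s) = p + s • ξ) (w : E) :
    dirDeriv (0, deriv γ t) (dirDeriv (w, 0) (costPair c)) (x, γ t) = -⟪ξ, w⟫ ∧
      dirDeriv (0, deriv γ t) (dirDeriv (0, deriv γ t) (dirDeriv (w, 0) (costPair c))) (x, γ t) +
        dirDeriv (0, deriv (deriv γ) t) (dirDeriv (w, 0) (costPair c)) (x, γ t) = 0 := by
  have hG : ContDiffAt ℝ 2 (dirDeriv (w, 0) (costPair c)) (x, γ t) :=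
    h.dirDeriv (by norm_num) _
  have hev : (fun s => dirDeriv (w, 0) (costPair c) (x, γ s)) =ᶠ[𝓝 t]
      fun s => -⟪p, w⟫ + s * -⟪ξ, w⟫ := by
    filter_upwards [hl, hγ.continuousAt.eventually
      (eventually_differentiableAt_right (by norm_num) h)] with s hs hd
    have := inner_negGradX hd w
    rw [hs, inner_add_left, real_inner_smul_left] at this
    linarith
  constructor
  · rw [← (deriv_comp_right (hG.differentiableAt (by norm_num))
      (hγ.differentiableAt (by norm_num))).deriv, hev.deriv_eq]
    simp
  · rw [← deriv_deriv_comp_right hG hγ, hev.deriv.deriv_eq, deriv_deriv_affine]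

/-- Along a `c*`-segment the `y`-derivative of the cost is affine. -/
theorem dirDeriv_of_negGradY_line {c : E → E → ℝ} {y : E} {γ : ℝ → E} {t : ℝ} {p ξ : E}
    (h : ContDiffAt ℝ 4 (costPair c) (γ t, y)) (hγ : ContDiffAt ℝ 2 γ t)
    (hl : ∀ᶠ s in 𝓝 t, negGradY c (γ s) y = p + s • ξ) (w : E) :
    dirDeriv (deriv γ t, 0) (dirDeriv (0, w) (costPair c)) (γ t, y) = -⟪ξ, w⟫ ∧
      dirDeriv (deriv γ t, 0) (dirDeriv (deriv γ t, 0) (dirDeriv (0, w) (costPair c))) (γ t, y) +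
        dirDeriv (deriv (deriv γ) t, 0) (dirDeriv (0, w) (costPair c)) (γ t, y) = 0 := by
  have hG : ContDiffAt ℝ 2 (dirDeriv (0, w) (costPair c)) (γ t, y) :=
    h.dirDeriv (by norm_num) _
  have hev : (fun s => dirDeriv (0, w) (costPair c) (γ s, y)) =ᶠ[𝓝 t]
      fun s => -⟪p, w⟫ + s * -⟪ξ, w⟫ := by
    filter_upwards [hl, hγ.continuousAt.eventually
      (eventually_differentiableAt_left (by norm_num) h)] with s hs hd
    have := inner_negGradY hd w
    rw [hs, inner_add_left, real_inner_smul_left] at this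
    linarith
  constructor
  · rw [← (deriv_comp_left (hG.differentiableAt (by norm_num))
      (hγ.differentiableAt (by norm_num))).deriv, hev.deriv_eq]
    simp
  · rw [← deriv_deriv_comp_left hG hγ, hev.deriv.deriv_eq, deriv_deriv_affine]

/-- The `c`-sectional curvature in terms of fourth derivatives of the cost. -/
theorem exists_cSectional_eq {c : E → E → ℝ} {Λ : Set E} {x y : E} (hΛ : IsOpen Λ)
    (hC : ∀ y' ∈ Λ, ContDiffAt ℝ 4 (costPair c) (x, y'))
    (hinj : InjOn (fun y' => negGradX c x y') Λ)
    (hb : ∀ y' ∈ Λ, Function.Injective (fderiv ℝ (fun y' => negGradX c x y') y'))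
    (hy : y ∈ Λ) (η v : E) :
    ∃ b : E,
      (∀ w, dirDeriv (0, v) (dirDeriv (0, v) (dirDeriv (w, 0) (costPair c))) (x, y) +
        dirDeriv (0, b) (dirDeriv (w, 0) (costPair c)) (x, y) = 0) ∧
      cSectional c Λ x y η (fderiv ℝ (fun y' => negGradX c x y') y v) =
        -(dirDeriv (0, v) (dirDeriv (0, v) (dirDeriv (η, 0) (dirDeriv (η, 0) (costPair c)))) (x, y)
          + dirDeriv (0, b) (dirDeriv (η, 0) (dirDeriv (η, 0) (costPair c))) (x, y)) := by
  set ξ := fderiv ℝ (fun y' => negGradX c x y') y v with hξ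
  obtain ⟨hγ, hl⟩ := contDiffAt_invFunOn_line hΛ (fun a ha => contDiffAt_negGradX (hC a ha))
    hinj hb (p := negGradX c x y) (ξ := ξ) (t := 0) ⟨y, hy, by simp⟩
  set γ : ℝ → E := fun r =>
    Function.invFunOn (fun y' => negGradX c x y') Λ (negGradX c x y + r • ξ) with hγdef
  have hγ0 : γ 0 = y := hinj hl.self_of_nhds.1 hy (by simpa using hl.self_of_nhds.2)
  have hCy : ContDiffAt ℝ 4 (costPair c) (x, γ 0) := hC _ hl.self_of_nhds.1
  have hseg := dirDeriv_of_negGradX_line hCy hγ (hl.mono fun _ h => h.2)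
  have hv : deriv γ 0 = v := by
    refine hb y hy (ext_inner_right ℝ fun w => ?_)
    rw [← hξ, inner_fderiv_negGradX (hC y hy), ← hγ0, (hseg w).1, neg_neg]
  refine ⟨deriv (deriv γ) 0, fun w => by simpa [hv, hγ0] using (hseg w).2, ?_⟩
  have hG : ContDiffAt ℝ 2 (dirDeriv (η, 0) (dirDeriv (η, 0) (costPair c))) (x, γ 0) :=
    (hCy.dirDeriv (m := 3) (by norm_num) _).dirDeriv (by norm_num) _
  have hev : (fun t : ℝ => -(iteratedFDeriv ℝ 2
      (fun x' => c x' (cExp c Λ x (negGradX c x y + t • ξ))) x ![η, η])) =ᶠ[𝓝 0]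
      fun t => -dirDeriv (η, 0) (dirDeriv (η, 0) (costPair c)) (x, γ t) := by
    filter_upwards [hl] with t ht
    exact congrArg Neg.neg (iteratedFDeriv_two_left ((hC _ ht.1).of_le (by norm_num)) η)
  have hneg : deriv (fun t => -dirDeriv (η, 0) (dirDeriv (η, 0) (costPair c)) (x, γ t)) =
      fun t => -deriv (fun t => dirDeriv (η, 0) (dirDeriv (η, 0) (costPair c)) (x, γ t)) t :=
    funext fun t => deriv.fun_neg
  rw [cSectional, hev.deriv.deriv_eq, hneg, deriv.fun_neg, deriv_deriv_comp_right hG hγ, hv, hγ0]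

theorem deriv_deriv_sub {f g : ℝ → ℝ} {t : ℝ} (hf : ContDiffAt ℝ 2 f t)
    (hg : ContDiffAt ℝ 2 g t) :
    deriv (deriv fun s => f s - g s) t = deriv (deriv f) t - deriv (deriv g) t := by
  have hev : deriv (fun s => f s - g s) =ᶠ[𝓝 t] fun s => deriv f s - deriv g s := by
    filter_upwards [hf.eventually_hasDerivAt.1, hg.eventually_hasDerivAt.1] with s hs hs'
    exact (hs.sub hs').deriv
  rw [hev.deriv_eq]
  exact (hf.eventually_hasDerivAt.2.sub hg.eventually_hasDerivAt.2).deriv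

theorem statement9 (c : E → E → ℝ) (Ω Λ : Set E) (hΩ : IsOpen Ω) (hΛ : IsOpen Λ)
    (h0 : A0 c Ω Λ) (h1 : A1 c Ω Λ) (h2 : A2 c Ω Λ)
    (hΩconv : CStarConvexSource c Ω Λ)
    (xm : E) (hxm : xm ∈ Ω) (y₀ : E) (hy₀ : y₀ ∈ Λ) (y₁ : E) (hy₁ : y₁ ∈ Λ)
    (hseg : segInTarget c Λ xm y₀ y₁)
    (h3 : A3W c Ω Λ) :
    ∀ θ ∈ Set.Icc (0:ℝ) 1, ∀ x ∈ Slevel c Ω Λ xm y₀ y₁ θ,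
      0 ≤ deriv (deriv (fun θ' => slide c Λ xm y₀ y₁ θ' x)) θ := by
  rintro θ hθ x ⟨hx, hxθ⟩
  set K := costPair c with hK
  have hC : ∀ x ∈ Ω, ∀ y ∈ Λ, ContDiffAt ℝ 4 K (x, y) := fun x hx y hy =>
    h0.contDiffAt (Filter.mem_of_superset ((hΩ.prod hΛ).mem_nhds ⟨hx, hy⟩)
      (Set.prod_mono subset_closure subset_closure))
  have hinjX : ∀ x ∈ Ω, InjOn (fun y' => negGradX c x y') Λ := fun x hx =>
    (h1.1 x hx).mono subset_closure
  have hbX : ∀ x ∈ Ω, ∀ y ∈ Λ, Function.Bijective (fderiv ℝ (fun y' => negGradX c x y') y) :=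
    fun x hx y hy => h2 x (subset_closure hx) y (subset_closure hy)
  -- the `c`-segment
  have hp : ∀ s, pSeg c xm y₀ y₁ s =
      negGradX c xm y₀ + s • (negGradX c xm y₁ - negGradX c xm y₀) := fun s => by
    rw [pSeg]; module
  have hY := contDiffAt_invFunOn_line hΛ (fun a ha => contDiffAt_negGradX (hC xm hxm a ha))
    (hinjX xm hxm) (fun y hy => (hbX xm hxm y hy).1) (hp θ ▸ hseg θ hθ)
  have hYdef : ySeg c Λ xm y₀ y₁ = fun r : ℝ => Function.invFunOn (fun y' => negGradX c xm y') Λ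
      (negGradX c xm y₀ + r • (negGradX c xm y₁ - negGradX c xm y₀)) := by
    funext r
    rw [ySeg, hp, cExp]
  simp only [← congrFun hYdef] at hY
  obtain ⟨hγ, hγl⟩ := hY
  set γ := ySeg c Λ xm y₀ y₁
  set y := γ θ with hydef
  have hy : y ∈ Λ := hγl.self_of_nhds.1
  set v := deriv γ θ with hv
  set a := deriv (deriv γ) θ with ha
  have hsegm := dirDeriv_of_negGradX_line (hC xm hxm y hy) hγ (hγl.mono fun _ h => h.2)
  have hcomp : ∀ z ∈ Ω, ContDiffAt ℝ 2 (fun s => K (z, γ s)) θ := fun z hz =>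
    ContDiffAt.comp (g := K) (f := fun s => (z, γ s)) θ
      ((hC z hz y hy).of_le (by norm_num)) (contDiffAt_const.prodMk hγ)
  have hslide : (fun θ' => slide c Λ xm y₀ y₁ θ' x) = fun s => K (xm, γ s) - K (x, γ s) := by
    funext s
    simp only [slide, hK, costPair, γ]
    ring
  have hd1 : ∀ z ∈ Ω, HasDerivAt (fun s => K (z, γ s)) (dirDeriv (0, v) K (z, y)) θ :=
    fun z hz => deriv_comp_right ((hC z hz y hy).differentiableAt (by norm_num))
      (hγ.differentiableAt (by norm_num))
  rw [hslide, ((hd1 xm hxm).fun_sub (hd1 x hx)).deriv] at hxθ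
  rw [hslide, deriv_deriv_sub (hcomp xm hxm) (hcomp x hx),
    deriv_deriv_comp_right ((hC xm hxm y hy).of_le (by norm_num)) hγ,
    deriv_deriv_comp_right ((hC x hx y hy).of_le (by norm_num)) hγ]
  change 0 ≤ dirDeriv (0, v) (dirDeriv (0, v) K) (xm, y) + dirDeriv (0, a) K (xm, y) -
    (dirDeriv (0, v) (dirDeriv (0, v) K) (x, y) + dirDeriv (0, a) K (x, y))
  -- the `c*`-segment joining `xm` to `x`
  set qm := negGradY c xm y with hqm
  set ζ := negGradY c x y - qm with hζ
  have hinjY : InjOn (fun x' => negGradY c x' y) Ω := (h1.2 y hy).mono subset_closure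
  have hX : ∀ t ∈ Icc (0 : ℝ) 1, _ := fun t ht =>
    contDiffAt_invFunOn_line hΩ (fun z hz => contDiffAt_negGradY (hC z hz y hy)) hinjY
      (fun z hz => injective_fderiv_negGradY (hC z hz y hy) (hbX z hz y hy).2)
      (p := qm) (ξ := ζ) (t := t)
      ((hΩconv y hy).add_smul_sub_mem ⟨xm, hxm, rfl⟩ ⟨x, hx, rfl⟩ ht)
  set X : ℝ → E := fun r => Function.invFunOn (fun x' => negGradY c x' y) Ω (qm + r • ζ) with hXdef
  have hXΩ : ∀ t ∈ Icc (0 : ℝ) 1, X t ∈ Ω := fun t ht => (hX t ht).2.self_of_nhds.1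
  have hX0 : X 0 = xm := hinjY (hXΩ 0 (by simp)) hxm
    ((hX 0 (by simp)).2.self_of_nhds.2.trans (by simp [hqm]))
  have hX1 : X 1 = x := hinjY (hXΩ 1 (by simp)) hx
    ((hX 1 (by simp)).2.self_of_nhds.2.trans (by simp [hζ]))
  have hXseg : ∀ t (ht : t ∈ Icc (0 : ℝ) 1), _ := fun t ht =>
    dirDeriv_of_negGradY_line (hC _ (hXΩ t ht) y hy) (hX t ht).1
      ((hX t ht).2.mono fun _ h => h.2)
  have hP : ∀ z ∈ Ω, ContDiffAt ℝ 2 (dirDeriv (0, v) (dirDeriv (0, v) K)) (z, y) := fun z hz =>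
    ((hC z hz y hy).dirDeriv (m := 3) (by norm_num) _).dirDeriv (by norm_num) _
  have hQ : ∀ z ∈ Ω, ContDiffAt ℝ 2 (dirDeriv (0, a) K) (z, y) := fun z hz =>
    (hC z hz y hy).dirDeriv (by norm_num) _
  have hPX : ∀ t ∈ Icc (0 : ℝ) 1,
      ContDiffAt ℝ 2 (fun s => -dirDeriv (0, v) (dirDeriv (0, v) K) (X s, y)) t := fun t ht =>
    ((hP _ (hXΩ t ht)).comp t ((hX t ht).1.prodMk contDiffAt_const)).neg
  have hQX : ∀ t ∈ Icc (0 : ℝ) 1,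
      ContDiffAt ℝ 2 (fun s => dirDeriv (0, a) K (X s, y)) t := fun t ht =>
    ContDiffAt.comp (g := dirDeriv (0, a) K) (f := fun s => (X s, y)) t (hQ _ (hXΩ t ht))
      ((hX t ht).1.prodMk contDiffAt_const)
  have hmain := le_of_deriv_zero_of_deriv_deriv_nonneg
    (g := fun s => -dirDeriv (0, v) (dirDeriv (0, v) K) (X s, y) - dirDeriv (0, a) K (X s, y))
    (fun t ht => (hPX t ht).sub (hQX t ht)) ?_ ?_
  · simp only [hX0, hX1] at hmain
    linarith
  · have h0' : (0 : ℝ) ∈ Icc (0 : ℝ) 1 := by simp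
    have hXd := (hX 0 h0').1.differentiableAt (by norm_num)
    have hdP := deriv_comp_left ((hP _ (hXΩ 0 h0')).differentiableAt (by norm_num)) hXd
    have hdQ := deriv_comp_left ((hQ _ (hXΩ 0 h0')).differentiableAt (by norm_num)) hXd
    rw [(hdP.fun_neg.fun_sub hdQ).deriv, hX0,
      (dirDeriv_comm_sq ((hC xm hxm y hy).of_le (by norm_num)) _ _).eq_of_nhds,
      dirDeriv_comm ((hC xm hxm y hy).of_le (by norm_num))]
    linarith [(hsegm (deriv X 0)).2]
  · intro t ht
    have hXt := hXΩ t ht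
    have hCt := hC _ hXt y hy
    have hCt2 : ContDiffAt ℝ 2 K (X t, y) := hCt.of_le (by norm_num)
    have hneg : deriv (fun s => -dirDeriv (0, v) (dirDeriv (0, v) K) (X s, y)) =
        fun s => -deriv (fun s => dirDeriv (0, v) (dirDeriv (0, v) K) (X s, y)) s :=
      funext fun s => deriv.fun_neg
    rw [deriv_deriv_sub (hPX t ht) (hQX t ht), hneg, deriv.fun_neg,
      deriv_deriv_comp_left (hP _ hXt) (hX t ht).1, deriv_deriv_comp_left (hQ _ hXt) (hX t ht).1,
      (hXseg t ht a).2, sub_zero]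
    obtain ⟨b, hb, hcurv⟩ := exists_cSectional_eq hΛ (hC _ hXt) (hinjX _ hXt)
      (fun y hy => (hbX _ hXt y hy).1) hy (deriv X t) v
    have horth : ⟪deriv X t, fderiv ℝ (fun y' => negGradX c (X t) y') y v⟫ = 0 := by
      rw [real_inner_comm, inner_fderiv_negGradX hCt, dirDeriv_comm hCt2, (hXseg t ht v).1,
        neg_neg, hζ, inner_sub_left, hqm,
        inner_negGradY ((hC x hx y hy).differentiableAt (by norm_num)),
        inner_negGradY ((hC xm hxm y hy).differentiableAt (by norm_num))]
      linarith
    have hnn := h3 _ hXt y hy _ _ horth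
    rw [hcurv] at hnn
    have e1 := dirDeriv_sq_comm_sq hCt (deriv X t, 0) (0, v)
    have e2 := (dirDeriv_comm_sq (hCt.of_le (by norm_num)) (deriv (deriv X) t, 0) (0, v)).eq_of_nhds
    have e3 := dirDeriv_comm hCt2 (deriv (deriv X) t, 0) (0, b)
    have e4 := (dirDeriv_comm_sq (hCt.of_le (by norm_num)) (0, b) (deriv X t, 0)).eq_of_nhds
    linarith [hb (deriv (deriv X) t), (hXseg t ht b).2]

end
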